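/- Suppose m = 2r and let b be an integer with r + 2 ≤ b ≤ 2r. For t ∈ ℝ set v₁(t) = e_{r+1} − t·e_{2r+1−b} and v₂(t) = e_b + t·e_r. Then for every t ∈ ℝ: v₁(t) ∈ F̃^r, v₂(t) ∈ F^b, the vectors v₁(t) and v₂(t) are linearly independent, their span is a ν-isotropic 2-dimensional subspace (hence lies in X(F̃^r, F^b)), and ν(v₁(t), v₂′(t)) = ν(v₁(t), e_r) = 1 ≠ 0. -/

import Mathlib

/-!
Orthogonal Grassmannian OG(2, ℂ^m) setup (0-based indexing: the paper's `e_k`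
is `e m ⟨k-1, _⟩`, and the paper's condition `i + j = m + 1` on 1-based indices
becomes `j = i.rev` on 0-based indices).
-/

noncomputable section

/-- The standard basis vector `e_{i+1}` of `ℂ^m`. -/
def e (m : ℕ) (i : Fin m) : Fin m → ℂ := Pi.single i 1

/-- The symmetric bilinear form `ν` with `ν(e_i, e_j) = 1` iff `i + j = m + 1`
(1-based), i.e. `ν(x, y) = ∑ i, x i * y (rev i)`. -/
def nu (m : ℕ) (x y : Fin m → ℂ) : ℂ := ∑ i : Fin m, x i * y i.rev

/-- `F m p` is the span `F^p` of the first `p` standard basis vectors. -/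
def F (m p : ℕ) : Submodule ℂ (Fin m → ℂ) :=
  Submodule.span ℂ {v | ∃ i : Fin m, (i : ℕ) < p ∧ v = e m i}

/-- A subspace is `ν`-isotropic if `ν` vanishes identically on it. -/
def IsIsotropic (m : ℕ) (E : Submodule ℂ (Fin m → ℂ)) : Prop :=
  ∀ x ∈ E, ∀ y ∈ E, nu m x y = 0

/-- The Schubert variety `X(A, B)` of `OG(2, ℂ^m)`: 2-dimensional `ν`-isotropic
subspaces `E` with `E ∩ A ≠ 0` and `E ⊆ B`. -/
def SchubX (m : ℕ) (A B : Submodule ℂ (Fin m → ℂ)) : Set (Submodule ℂ (Fin m → ℂ)) :=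
  {E | Module.finrank ℂ E = 2 ∧ IsIsotropic m E ∧ E ⊓ A ≠ ⊥ ∧ E ≤ B}

/-- `X(A, B)` is horizontal: for all differentiable curves `v₁ ∈ A`, `v₂ ∈ B`
which stay linearly independent and span a `ν`-isotropic plane, each `v_i`
pairs to zero with each derivative `v_j'`. -/
def Horizontal (m : ℕ) (A B : Submodule ℂ (Fin m → ℂ)) : Prop :=
  ∀ v₁ v₂ : ℝ → (Fin m → ℂ),
    Differentiable ℝ v₁ → Differentiable ℝ v₂ →
    (∀ t, v₁ t ∈ A) → (∀ t, v₂ t ∈ B) →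
    (∀ t, LinearIndependent ℂ ![v₁ t, v₂ t]) →
    (∀ t, IsIsotropic m (Submodule.span ℂ {v₁ t, v₂ t})) →
    ∀ t : ℝ,
      nu m (v₁ t) (deriv v₁ t) = 0 ∧ nu m (v₁ t) (deriv v₂ t) = 0 ∧
      nu m (v₂ t) (deriv v₁ t) = 0 ∧ nu m (v₂ t) (deriv v₂ t) = 0

/-- For `m = 2r`, `F̃^r` is the span of `e_1, …, e_{r−1}, e_{r+1}`
(0-based: indices `< r - 1` together with index `r`). -/
def Ftilde (r : ℕ) : Submodule ℂ (Fin (2 * r) → ℂ) :=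
  Submodule.span ℂ
    {v | ∃ i : Fin (2 * r), ((i : ℕ) < r - 1 ∨ (i : ℕ) = r) ∧ v = e (2 * r) i}

lemma e_mem_F {m p : ℕ} (i : Fin m) (hi : (i : ℕ) < p) : e m i ∈ F m p :=
  Submodule.subset_span ⟨i, hi, rfl⟩

lemma e_mem_Ftilde {r : ℕ} (i : Fin (2 * r)) (hi : (i : ℕ) < r - 1 ∨ (i : ℕ) = r) :
    e (2 * r) i ∈ Ftilde r :=
  Submodule.subset_span ⟨i, hi, rfl⟩

lemma nu_add_left (m : ℕ) (x y z : Fin m → ℂ) : nu m (x + y) z = nu m x z + nu m y z := by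
  simp [nu, add_mul, Finset.sum_add_distrib]

lemma nu_smul_left (m : ℕ) (c : ℂ) (x y : Fin m → ℂ) : nu m (c • x) y = c * nu m x y := by
  simp [nu, mul_assoc, Finset.mul_sum]

lemma nu_comm (m : ℕ) (x y : Fin m → ℂ) : nu m x y = nu m y x :=
  Fintype.sum_equiv Fin.revPerm _ _ fun i => by simp [mul_comm]

lemma nu_add_right (m : ℕ) (x y z : Fin m → ℂ) : nu m x (y + z) = nu m x y + nu m x z := by
  simp only [nu_comm m x, nu_add_left]

lemma nu_smul_right (m : ℕ) (c : ℂ) (x y : Fin m → ℂ) : nu m x (c • y) = c * nu m x y := by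
  simp only [nu_comm m x, nu_smul_left]

lemma nu_sub_left (m : ℕ) (x y z : Fin m → ℂ) : nu m (x - y) z = nu m x z - nu m y z := by
  simp [nu, sub_mul, Finset.sum_sub_distrib]

lemma nu_sub_right (m : ℕ) (x y z : Fin m → ℂ) : nu m x (y - z) = nu m x y - nu m x z := by
  simp only [nu_comm m x, nu_sub_left]

lemma nu_e_e (m : ℕ) (i j : Fin m) :
    nu m (e m i) (e m j) = if (i : ℕ) + j + 1 = m then 1 else 0 := by
  have h : i.rev = j ↔ (i : ℕ) + j + 1 = m := by
    rw [Fin.ext_iff, Fin.val_rev]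
    omega
  rw [nu, Fintype.sum_eq_single i fun k hk => by simp [e, hk]]
  simp [e, Pi.single_apply, h]

lemma isIsotropic_span_pair {m : ℕ} {x y : Fin m → ℂ} (hxx : nu m x x = 0)
    (hxy : nu m x y = 0) (hyy : nu m y y = 0) :
    IsIsotropic m (Submodule.span ℂ {x, y}) := by
  intro u hu v hv
  obtain ⟨a, b, rfl⟩ := Submodule.mem_span_pair.1 hu
  obtain ⟨c, d, rfl⟩ := Submodule.mem_span_pair.1 hv
  simp [nu_add_left, nu_add_right, nu_smul_left, nu_smul_right, nu_comm m y x, hxx, hxy, hyy]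

lemma F_mono {m p q : ℕ} (h : p ≤ q) : F m p ≤ F m q :=
  Submodule.span_mono fun _ ⟨i, hi, hv⟩ => ⟨i, hi.trans_le h, hv⟩

lemma Ftilde_le_F (r : ℕ) : Ftilde r ≤ F (2 * r) (r + 1) :=
  Submodule.span_mono fun _ ⟨i, hi, hv⟩ => ⟨i, by omega, hv⟩

lemma span_pair_mem_SchubX {m : ℕ} {A B : Submodule ℂ (Fin m → ℂ)} {x y : Fin m → ℂ}
    (hli : LinearIndependent ℂ ![x, y]) (hiso : IsIsotropic m (Submodule.span ℂ {x, y}))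
    (hxA : x ∈ A) (hxB : x ∈ B) (hyB : y ∈ B) :
    Submodule.span ℂ {x, y} ∈ SchubX m A B := by
  refine ⟨?_, hiso, ?_, ?_⟩
  · rw [← Matrix.range_cons_cons_empty x y ![], finrank_span_eq_card hli, Fintype.card_fin]
  · exact (Submodule.ne_bot_iff _).2
      ⟨x, ⟨Submodule.subset_span (by simp), hxA⟩, by simpa using hli.ne_zero 0⟩
  · rw [Submodule.span_le]
    rintro _ (rfl | rfl)
    exacts [hxB, hyB]

/-- For `m = 2r` and `r + 2 ≤ b ≤ 2r`, the curves
`v₁(t) = e_{r+1} − t e_{2r+1−b}` and `v₂(t) = e_b + t e_r` stay in `F̃^r` resp.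
`F^b`, are linearly independent, span a `ν`-isotropic 2-plane (hence a point of
`X(F̃^r, F^b)`), and satisfy `ν(v₁(t), v₂′(t)) = ν(v₁(t), e_r) = 1 ≠ 0`. -/
theorem stmt4 (r b : ℕ) (hb1 : r + 2 ≤ b) (hb2 : b ≤ 2 * r)
    (v₁ v₂ : ℝ → Fin (2 * r) → ℂ)
    (hv₁ : v₁ = fun (t : ℝ) =>
      e (2 * r) ⟨r, by omega⟩ - (t : ℂ) • e (2 * r) ⟨2 * r - b, by omega⟩)
    (hv₂ : v₂ = fun (t : ℝ) =>
      e (2 * r) ⟨b - 1, by omega⟩ + (t : ℂ) • e (2 * r) ⟨r - 1, by omega⟩) :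
    ∀ t : ℝ,
      v₁ t ∈ Ftilde r ∧
      v₂ t ∈ F (2 * r) b ∧
      LinearIndependent ℂ ![v₁ t, v₂ t] ∧
      IsIsotropic (2 * r) (Submodule.span ℂ {v₁ t, v₂ t}) ∧
      Module.finrank ℂ (Submodule.span ℂ {v₁ t, v₂ t}) = 2 ∧
      Submodule.span ℂ {v₁ t, v₂ t} ∈ SchubX (2 * r) (Ftilde r) (F (2 * r) b) ∧
      nu (2 * r) (v₁ t) (deriv v₂ t) =
        nu (2 * r) (v₁ t) (e (2 * r) ⟨r - 1, by omega⟩) ∧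
      nu (2 * r) (v₁ t) (deriv v₂ t) = 1 ∧
      nu (2 * r) (v₁ t) (deriv v₂ t) ≠ 0 := by
  intro t
  have hA : v₁ t ∈ Ftilde r := by
    rw [hv₁]
    exact sub_mem (e_mem_Ftilde _ (Or.inr rfl))
      (Submodule.smul_mem _ _ (e_mem_Ftilde _ (Or.inl (by simp only; omega))))
  have hB : v₂ t ∈ F (2 * r) b := by
    rw [hv₂]
    exact add_mem (e_mem_F _ (by simp only; omega))
      (Submodule.smul_mem _ _ (e_mem_F _ (by simp only; omega)))
  have hli : LinearIndependent ℂ ![v₁ t, v₂ t] := by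
    rw [LinearIndependent.pair_iff]
    intro c d h
    have h₁ := congrFun h ⟨r, by omega⟩
    have h₂ := congrFun h ⟨b - 1, by omega⟩
    have n₁ : r ≠ 2 * r - b := by omega
    have n₂ : r ≠ b - 1 := by omega
    have n₃ : r ≠ r - 1 := by omega
    have n₄ : b - 1 ≠ 2 * r - b := by omega
    have n₅ : b - 1 ≠ r - 1 := by omega
    simp [hv₁, hv₂, e, n₁, n₂, n₃] at h₁
    simp [hv₁, hv₂, e, n₂.symm, n₄, n₅] at h₂
    exact ⟨h₁, h₂⟩
  have hiso : IsIsotropic (2 * r) (Submodule.span ℂ {v₁ t, v₂ t}) := by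
    have c₁ : r + r + 1 ≠ 2 * r := by omega
    have c₂ : r + (2 * r - b) + 1 ≠ 2 * r := by omega
    have c₃ : 2 * r - b + r + 1 ≠ 2 * r := by omega
    have c₄ : 2 * r - b + (2 * r - b) + 1 ≠ 2 * r := by omega
    have c₅ : r + (b - 1) + 1 ≠ 2 * r := by omega
    have c₆ : r + (r - 1) + 1 = 2 * r := by omega
    have c₇ : 2 * r - b + (b - 1) + 1 = 2 * r := by omega
    have c₈ : 2 * r - b + (r - 1) + 1 ≠ 2 * r := by omega
    have c₉ : b - 1 + (b - 1) + 1 ≠ 2 * r := by omega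
    have d₁ : b - 1 + (r - 1) + 1 ≠ 2 * r := by omega
    have d₂ : r - 1 + (b - 1) + 1 ≠ 2 * r := by omega
    have d₃ : r - 1 + (r - 1) + 1 ≠ 2 * r := by omega
    apply isIsotropic_span_pair <;>
      simp only [hv₁, hv₂, nu_add_left, nu_add_right, nu_sub_left, nu_sub_right, nu_smul_left,
        nu_smul_right, nu_e_e, if_pos, c₁, c₂, c₃, c₄, c₅, c₆, c₇, c₈, c₉, d₁, d₂, d₃,
        if_false] <;>
      ring
  have hX := span_pair_mem_SchubX hli hiso hA (F_mono (by omega) (Ftilde_le_F r hA)) hB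
  have hderiv : deriv v₂ t = e (2 * r) ⟨r - 1, by omega⟩ := by
    rw [hv₂]
    have h := ((Complex.ofRealCLM.hasDerivAt (x := t)).smul_const
      (e (2 * r) ⟨r - 1, by omega⟩)).const_add (e (2 * r) ⟨b - 1, by omega⟩)
    simpa using h.deriv
  have hnu : nu (2 * r) (v₁ t) (e (2 * r) ⟨r - 1, by omega⟩) = 1 := by
    have c₁ : r + (r - 1) + 1 = 2 * r := by omega
    have c₂ : 2 * r - b + (r - 1) + 1 ≠ 2 * r := by omega
    simp only [hv₁, nu_sub_left, nu_smul_left, nu_e_e, c₁, c₂, if_true, if_false]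
    ring
  rw [hderiv]
  exact ⟨hA, hB, hli, hiso, hX.1, hX, rfl, hnu, by simp [hnu]⟩

end
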